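/- Let μ be a complex number and n ≥ 1 an integer. Then b_{2n+1}(1,1,μ) · b_{2n}(0,1,μ) · b_{2n}(1,0,μ) = − b_{2n−1}(1,1,μ) · b_{2n+1}(0,1,μ) · b_{2n+1}(1,0,μ). (Equivalently, when the denominators are nonzero, b_{2n+1}(1,1)/b_{2n−1}(1,1) = −( b_{2n+1}(0,1)/b_{2n}(0,1) ) · ( b_{2n+1}(1,0)/b_{2n}(1,0) ).) -/

import Mathlib

/-- Generalized binomial coefficient `C(x,k) = x(x-1)⋯(x-k+1)/k!` for complex `x`. -/
noncomputable def gbinom (x : ℂ) (k : ℕ) : ℂ :=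
  (∏ i ∈ Finset.range k, (x - i)) / (k.factorial : ℂ)

/-- Pochhammer symbol `(x)_k = x(x+1)⋯(x+k-1)`. -/
noncomputable def poch (x : ℂ) (k : ℕ) : ℂ :=
  ∏ i ∈ Finset.range k, (x + i)
/-- `b_n(I,J,μ)`: determinant of the `n×n` matrix with rows indexed by
`i = I,…,n-1+I`, columns indexed by `j = J,…,n-1+J`, and entries
`-δ_{i,j} + C(μ+i+j-2, j)`. -/
noncomputable def bdet (μ : ℂ) (n I J : ℕ) : ℂ :=
  Matrix.det (Matrix.of fun i j : Fin n =>
    (if I + i.1 = J + j.1 then (-1 : ℂ) else 0)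
      + gbinom (μ + ((I + i.1 : ℕ) : ℂ) + ((J + j.1 : ℕ) : ℂ) - 2) (J + j.1))

open Finset in
theorem Ring.smeval_descPochhammer_eq_prod_range {R : Type*} [CommRing R] (x : R) (n : ℕ) :
    (descPochhammer ℤ n).smeval x = ∏ i ∈ range n, (x - i) := by
  induction n with
  | zero => simp
  | succ n ih =>
    rw [prod_range_succ, ← ih, descPochhammer_succ_right, Polynomial.smeval_mul]
    simp [Polynomial.smeval_sub, Polynomial.smeval_natCast]

theorem gbinom_eq_choose (x : ℂ) (k : ℕ) : gbinom x k = Ring.choose x k := by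
  rw [gbinom, Ring.choose_eq_smul, Ring.smeval_descPochhammer_eq_prod_range, smul_eq_mul,
    div_eq_inv_mul]

namespace Matrix

/-- Jacobi's identity for the complementary minors of the adjugate, for a block matrix. -/
theorem det_mul_det_toBlocks₁₁_adjugate {m n R : Type*} [Fintype m] [Fintype n] [DecidableEq m]
    [DecidableEq n] [CommRing R] (A : Matrix (m ⊕ n) (m ⊕ n) R) :
    A.det * A.adjugate.toBlocks₁₁.det = A.det ^ Fintype.card m * A.toBlocks₂₂.det := by
  have h : A * fromBlocks A.adjugate.toBlocks₁₁ 0 A.adjugate.toBlocks₂₁ 1 =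
      fromBlocks (A.det • 1) A.toBlocks₁₂ 0 A.toBlocks₂₂ := by
    have hA := A.mul_adjugate
    rw [← fromBlocks_toBlocks A, ← fromBlocks_toBlocks (adjugate _), fromBlocks_multiply,
      ← fromBlocks_one, fromBlocks_smul, fromBlocks_inj] at hA
    simp only [fromBlocks_toBlocks] at hA
    obtain ⟨h₁, -, h₂, -⟩ := hA
    calc
      _ = fromBlocks A.toBlocks₁₁ A.toBlocks₁₂ A.toBlocks₂₁ A.toBlocks₂₂ *
          fromBlocks A.adjugate.toBlocks₁₁ 0 A.adjugate.toBlocks₂₁ 1 := by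
        rw [fromBlocks_toBlocks]
      _ = _ := by
        rw [fromBlocks_multiply, h₁, h₂]
        simp
  have h' := congrArg det h
  rw [det_mul, det_fromBlocks_zero₁₂, det_fromBlocks_zero₂₁, det_one, mul_one, det_smul, det_one,
    mul_one] at h'
  exact h'

/-- Jacobi's identity for the `2 × 2` minors of the adjugate. -/
theorem det_toBlocks₁₁_adjugate_fin_two {n R : Type*} [Fintype n] [DecidableEq n] [CommRing R]
    (A : Matrix (Fin 2 ⊕ n) (Fin 2 ⊕ n) R) :
    A.adjugate.toBlocks₁₁.det = A.det * A.toBlocks₂₂.det := by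
  let X := mvPolynomialX (Fin 2 ⊕ n) (Fin 2 ⊕ n) ℤ
  have hX : X.adjugate.toBlocks₁₁.det = X.det * X.toBlocks₂₂.det := by
    apply mul_left_cancel₀ (show X.det ≠ 0 from det_mvPolynomialX_ne_zero _ ℤ)
    rw [det_mul_det_toBlocks₁₁_adjugate, Fintype.card_fin]
    ring
  let f : MvPolynomial ((Fin 2 ⊕ n) × (Fin 2 ⊕ n)) ℤ →ₐ[ℤ] R := MvPolynomial.aeval fun p => A p.1 p.2
  have hf : f.mapMatrix X = A := mvPolynomialX_mapMatrix_aeval ℤ A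
  have h := congrArg f hX
  rw [map_mul, AlgHom.map_det, AlgHom.map_det, AlgHom.map_det, hf] at h
  convert h using 2
  · rw [← hf, ← AlgHom.map_adjugate]
    rfl
  · rw [← hf]
    rfl

/-- The Desnanot-Jacobi identity (Dodgson condensation). -/
theorem det_mul_det_submatrix_inner {R : Type*} [CommRing R] {m : ℕ}
    (A : Matrix (Fin (m + 2)) (Fin (m + 2)) R) :
    A.det * (A.submatrix (fun i : Fin m => i.succ.castSucc) fun i => i.succ.castSucc).det =
      (A.submatrix Fin.succ Fin.succ).det * (A.submatrix Fin.castSucc Fin.castSucc).det -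
        (A.submatrix Fin.succ Fin.castSucc).det * (A.submatrix Fin.castSucc Fin.succ).det := by
  let g : Fin 2 ⊕ Fin m → Fin (m + 2) :=
    Sum.elim ![0, Fin.last _] fun i => i.succ.castSucc
  have hg : Function.Bijective g := by
    rw [Fintype.bijective_iff_injective_and_card]
    refine ⟨?_, by simp [add_comm]⟩
    rintro (i | i) (j | j) h
    · fin_cases i <;> fin_cases j <;> simp_all [g, Fin.ext_iff]
    · have := j.2
      fin_cases i <;> simp [g, Fin.ext_iff] at h
      omega
    · have := i.2
      fin_cases j <;> simp [g, Fin.ext_iff] at h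
      omega
    · simpa [g, Fin.ext_iff] using h
  let e := Equiv.ofBijective g hg
  have h := det_toBlocks₁₁_adjugate_fin_two (A.submatrix e e)
  rw [adjugate_submatrix_equiv_self, det_submatrix_equiv_self, det_fin_two] at h
  have h₀ : e (Sum.inl 0) = 0 := rfl
  have h₁ : e (Sum.inl 1) = Fin.last _ := rfl
  simp only [toBlocks₁₁, of_apply, submatrix_apply, h₀, h₁, adjugate_fin_succ_eq_det_submatrix,
    Fin.succAbove_zero, Fin.succAbove_last] at h
  have hs : ((-1 : R) ^ (m + 1)) * (-1) ^ (m + 1) = 1 := by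
    rw [← mul_pow]; simp
  have hi : (A.submatrix e e).toBlocks₂₂ =
      A.submatrix (fun i : Fin m => i.succ.castSucc) fun i => i.succ.castSucc := rfl
  rw [← hi, ← h]
  simp only [Fin.val_zero, Fin.val_last, add_zero, zero_add, pow_zero, one_mul, pow_add _ (m + 1)]
  linear_combination ((A.submatrix Fin.succ Fin.succ).det *
      (A.submatrix Fin.castSucc Fin.castSucc).det -
        (A.submatrix Fin.succ Fin.castSucc).det * (A.submatrix Fin.castSucc Fin.succ).det) * hs

section Involutions

variable {n R : Type*} [Fintype n] [DecidableEq n] [CommRing R] {P Q : Matrix n n R}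

theorem mul_sub_one_mul_of_involutive (hP : P * P = 1) (hQ : Q * Q = 1) :
    P * (P * Q - 1) * P = -(Q * P * (P * Q - 1)) := by
  have h : Q * P * (P * Q) = 1 := by
    rw [Matrix.mul_assoc, ← Matrix.mul_assoc P, hP, Matrix.one_mul, hQ]
  rw [Matrix.mul_sub, Matrix.mul_sub, h, ← Matrix.mul_assoc, hP, Matrix.one_mul, Matrix.mul_one,
    Matrix.mul_one, Matrix.sub_mul, hP, neg_sub]

theorem adjugate_eq_det_smul_of_involutive (hP : P * P = 1) : P.adjugate = P.det • P := by
  rw [← Matrix.mul_one P.adjugate, ← hP, ← Matrix.mul_assoc, adjugate_mul, smul_mul, Matrix.one_mul]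

/-- The determinant of `PQ - 1`, for involutions `P`, `Q` with `det (PQ) = 1`. -/
theorem det_mul_sub_one_of_involutive (hP : P * P = 1) (hQ : Q * Q = 1)
    (hd : P.det * Q.det = 1) :
    (P * Q - 1).det = (-1) ^ Fintype.card n * (P * Q - 1).det := by
  have h := congrArg det (mul_sub_one_mul_of_involutive hP hQ)
  have hPd : P.det * P.det = 1 := by rw [← det_mul, hP, det_one]
  rw [det_neg, det_mul, det_mul, det_mul, det_mul] at h
  linear_combination h - (P * Q - 1).det * hPd +
    (-1) ^ Fintype.card n * (P * Q - 1).det * hd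

/-- The adjugate of `PQ - 1` in even size, for involutions `P`, `Q` with `det (PQ) = 1`. -/
theorem mul_adjugate_mul_of_involutive (hP : P * P = 1) (hQ : Q * Q = 1)
    (hd : P.det * Q.det = 1) (hn : Odd (Fintype.card n - 1)) :
    P * (P * Q - 1).adjugate * P = -((P * Q - 1).adjugate * (P * Q)) := by
  have h := congrArg adjugate (mul_sub_one_mul_of_involutive hP hQ)
  have hPd : P.det * P.det = 1 := by rw [← det_mul, hP, det_one]
  rw [← neg_one_smul R, adjugate_smul, hn.neg_one_pow, adjugate_mul_distrib, adjugate_mul_distrib,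
    adjugate_mul_distrib, adjugate_mul_distrib, adjugate_eq_det_smul_of_involutive hP,
    adjugate_eq_det_smul_of_involutive hQ] at h
  simp only [smul_mul, Matrix.mul_smul, smul_smul, hPd, hd, mul_comm Q.det, one_smul,
    neg_one_smul] at h
  rw [Matrix.mul_assoc, h]

end Involutions

/-- The upper triangular matrix with entries `(-1) ^ i * C(a + j, j - i)`. -/
noncomputable def signedPascal (N : ℕ) (a : ℂ) : Matrix (Fin N) (Fin N) ℂ :=
  of fun i j => if i ≤ j then (-1) ^ i.1 * Ring.choose (a + j.1) (j.1 - i.1) else 0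

theorem choose_add_eq_neg_one_pow_mul (a : ℂ) (i t : ℕ) :
    Ring.choose (a + (i + t : ℕ)) t = (-1) ^ t * Ring.choose (-(a + i + 1)) t := by
  rw [Ring.choose_neg, Int.negOnePow_def]
  have h : (a + i + 1 + t - 1 : ℂ) = a + (i + t : ℕ) := by push_cast; ring
  rw [h]
  rcases Nat.even_or_odd t with ht | ht <;> simp [Units.smul_def, ht.neg_one_pow]

theorem signedPascal_mul_self (N : ℕ) (a : ℂ) : signedPascal N a * signedPascal N a = 1 := by
  ext i j
  rw [mul_apply]
  simp only [signedPascal, of_apply]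
  rcases lt_or_ge j i with hij | hij
  · rw [one_apply_ne hij.ne']
    refine Finset.sum_eq_zero fun k _ => ?_
    by_cases h : i ≤ k
    · have h' : ¬ k ≤ j := fun h' => hij.not_ge (h.trans h')
      simp [h']
    · simp [h]
  · obtain ⟨d, hd⟩ := Nat.exists_eq_add_of_le (Fin.le_def.1 hij)
    have hv := Ring.add_choose_eq d (Commute.all (-(a + i.1 + 1)) (a + j.1))
    have hs : -(a + i.1 + 1) + (a + j.1) = (d : ℂ) - 1 := by rw [hd]; push_cast; ring
    rw [hs, Finset.Nat.sum_antidiagonal_eq_sum_range_succ_mk] at hv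
    have h1 : (1 : Matrix (Fin N) (Fin N) ℂ) i j = Ring.choose ((d : ℂ) - 1) d := by
      rcases d with _ | d
      · rw [Ring.choose_zero_right, show i = j from Fin.ext hd.symm, one_apply_eq]
      · have : ((d + 1 : ℕ) : ℂ) - 1 = (d : ℕ) := by push_cast; ring
        rw [this, Ring.choose_natCast, Nat.choose_succ_self, one_apply_ne]
        · simp
        · rintro rfl; omega
    rw [h1, hv]
    symm
    rw [Finset.sum_fin_eq_sum_range]
    refine Finset.sum_of_injOn (fun t => i.1 + t) (fun _ _ _ _ h => by simpa using h) ?_ ?_ ?_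
    · intro t ht
      have := j.2
      simp only [Finset.coe_range, Set.mem_Iio] at ht ⊢
      omega
    · intro k hk hk'
      have hk'' : ¬ (i.1 ≤ k ∧ k ≤ j.1) := fun h => hk' ⟨k - i.1, by simp; omega, by simp; omega⟩
      simp only [Fin.le_def]
      by_cases h : i.1 ≤ k
      · have h' : ¬ k ≤ j.1 := fun h' => hk'' ⟨h, h'⟩
        simp [h']
      · simp [h]
    · intro t ht
      have hj := j.2
      rw [Finset.mem_range] at ht
      have h₁ : i.1 + t < N := by omega
      have h₂ : i.1 + t ≤ j.1 := by omega
      have h₃ : j.1 - (i.1 + t) = d - t := by omega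
      have h₄ : ((-1 : ℂ) ^ i.1) * (-1) ^ i.1 = 1 := by rw [← mul_pow]; simp
      have h₅ : ((-1 : ℂ) ^ t) * (-1) ^ t = 1 := by rw [← mul_pow]; simp
      simp only [Fin.le_def, h₁, h₂, h₃, dif_pos, if_true, Nat.le_add_right, Nat.add_sub_cancel_left,
        choose_add_eq_neg_one_pow_mul, pow_add]
      linear_combination -(Ring.choose (-(a + i.1 + 1)) t * Ring.choose (a + j.1) (d - t)) *
        (h₅ + (-1) ^ t * (-1) ^ t * h₄)

theorem det_signedPascal (N : ℕ) (a : ℂ) : (signedPascal N a).det = ∏ i : Fin N, (-1) ^ i.1 := by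
  rw [det_of_isUpperTriangular fun i j (h : j < i) => by simp [signedPascal, h.not_ge]]
  simp [signedPascal]

theorem det_transpose_signedPascal_mul_det (N : ℕ) (a b : ℂ) :
    (signedPascal N a)ᵀ.det * (signedPascal N b).det = 1 := by
  rw [det_transpose, det_signedPascal, det_signedPascal, ← Finset.prod_mul_distrib]
  exact Finset.prod_eq_one fun i _ => by rw [← mul_pow]; simp

theorem transpose_signedPascal_mul_apply (N : ℕ) (a : ℂ) (i j : Fin N) :
    ((signedPascal N 0)ᵀ * signedPascal N a) i j = Ring.choose (a + i.1 + j.1) j.1 := by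
  have hs : a + i.1 + j.1 = (i.1 : ℂ) + (a + j.1) := by ring
  rw [hs, Ring.add_choose_eq _ (Commute.all _ _), Finset.Nat.sum_antidiagonal_eq_sum_range_succ_mk,
    mul_apply]
  simp only [transpose_apply, signedPascal, of_apply, Fin.le_def]
  rw [Finset.sum_fin_eq_sum_range]
  symm
  refine Finset.sum_subset_zero_on_sdiff ?_ ?_ ?_
  · intro t ht
    have := j.2
    simp only [Finset.mem_range] at ht ⊢
    omega
  · intro k hk
    simp only [Finset.mem_sdiff, Finset.mem_range] at hk
    have : ¬ k ≤ j.1 := by omega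
    simp [this]
  · intro k hk
    have hj := j.2
    rw [Finset.mem_range] at hk
    have h₁ : k < N := by omega
    have h₂ : k ≤ j.1 := by omega
    have h₄ : ((-1 : ℂ) ^ k) * (-1) ^ k = 1 := by rw [← mul_pow]; simp
    simp only [h₁, dif_pos, h₂, if_true,
      zero_add, Ring.choose_natCast]
    rcases le_or_gt k i.1 with hki | hki
    · rw [if_pos hki, Nat.choose_symm hki]
      linear_combination -((i.1.choose k : ℂ) * Ring.choose (a + j.1) (j.1 - k)) * h₄
    · rw [if_neg hki.not_ge, Nat.choose_eq_zero_of_lt hki]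
      simp

end Matrix

open Matrix

/-- The `N × N` matrix whose determinant is `bdet μ N 0 0`. -/
noncomputable def bmatrix (μ : ℂ) (N : ℕ) : Matrix (Fin N) (Fin N) ℂ :=
  (signedPascal N 0)ᵀ * signedPascal N (μ - 2) - 1

theorem bmatrix_apply (μ : ℂ) (N : ℕ) (i j : Fin N) :
    bmatrix μ N i j = (if i.1 = j.1 then (-1 : ℂ) else 0) +
      gbinom (μ + (i.1 : ℂ) + (j.1 : ℂ) - 2) j.1 := by
  have h : μ + (i.1 : ℂ) + (j.1 : ℂ) - 2 = μ - 2 + i.1 + j.1 := by ring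
  rw [bmatrix, Matrix.sub_apply, transpose_signedPascal_mul_apply, gbinom_eq_choose, one_apply, h]
  simp only [Fin.ext_iff]
  split_ifs <;> ring

theorem bdet_zero_zero (μ : ℂ) (N : ℕ) : bdet μ N 0 0 = (bmatrix μ N).det := by
  rw [bdet]
  congr 1
  ext i j
  simp [bmatrix_apply]

theorem bdet_eq_det_submatrix (μ : ℂ) {N n I J : ℕ} (f g : Fin n → Fin N)
    (hf : ∀ i, (f i).1 = I + i.1) (hg : ∀ j, (g j).1 = J + j.1) :
    bdet μ n I J = ((bmatrix μ N).submatrix f g).det := by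
  rw [bdet]
  congr 1
  ext i j
  rw [submatrix_apply, bmatrix_apply, hf, hg, of_apply]

theorem bdet_condensation (μ : ℂ) (m : ℕ) :
    bdet μ (m + 2) 0 0 * bdet μ m 1 1 =
      bdet μ (m + 1) 1 1 * bdet μ (m + 1) 0 0 - bdet μ (m + 1) 1 0 * bdet μ (m + 1) 0 1 := by
  have h := det_mul_det_submatrix_inner (bmatrix μ (m + 2))
  have hs {k : ℕ} (i : Fin k) : i.succ.1 = 1 + i.1 := by simp [add_comm]
  have hc {k : ℕ} (i : Fin k) : i.castSucc.1 = 0 + i.1 := by simp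
  have hi (i : Fin m) : i.succ.castSucc.1 = 1 + i.1 := hs i
  rwa [← bdet_zero_zero, ← bdet_eq_det_submatrix μ (fun i : Fin m => i.succ.castSucc) _ hi hi,
    ← bdet_eq_det_submatrix μ (Fin.succ (n := m + 1)) _ hs hs,
    ← bdet_eq_det_submatrix μ (Fin.castSucc (n := m + 1)) _ hc hc,
    ← bdet_eq_det_submatrix μ (Fin.succ (n := m + 1)) _ hs hc,
    ← bdet_eq_det_submatrix μ (Fin.castSucc (n := m + 1)) _ hc hs] at h

theorem transpose_signedPascal_mul_self (N : ℕ) (a : ℂ) :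
    (signedPascal N a)ᵀ * (signedPascal N a)ᵀ = 1 := by
  rw [← transpose_mul, signedPascal_mul_self, transpose_one]

theorem bdet_zero_zero_of_odd (μ : ℂ) {N : ℕ} (hN : Odd N) : bdet μ N 0 0 = 0 := by
  have h := det_mul_sub_one_of_involutive (transpose_signedPascal_mul_self N 0)
    (signedPascal_mul_self N (μ - 2)) (det_transpose_signedPascal_mul_det N 0 (μ - 2))
  rw [Fintype.card_fin, hN.neg_one_pow, neg_one_mul] at h
  rw [bdet_zero_zero]
  exact self_eq_neg.1 h

theorem bdet_one_one_of_odd (μ : ℂ) {m : ℕ} (hm : Odd m) :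
    bdet μ m 1 1 = -bdet μ (m + 1) 0 0 := by
  have hs (i : Fin m) : i.succ.1 = 1 + i.1 := by simp [add_comm]
  have hA : bdet μ m 1 1 = (bmatrix μ (m + 1)).adjugate 0 0 := by
    rw [bdet_eq_det_submatrix μ _ _ hs hs, adjugate_fin_succ_eq_det_submatrix]
    simp
  have h := mul_adjugate_mul_of_involutive (transpose_signedPascal_mul_self (m + 1) 0)
    (signedPascal_mul_self (m + 1) (μ - 2)) (det_transpose_signedPascal_mul_det (m + 1) 0 (μ - 2))
    (by simpa using hm)
  rw [← bmatrix] at h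
  have hPQ : (signedPascal (m + 1) 0)ᵀ * signedPascal (m + 1) (μ - 2) = bmatrix μ (m + 1) + 1 := by
    rw [bmatrix, sub_add_cancel]
  have hcol (i : Fin (m + 1)) : bmatrix μ (m + 1) i 0 = 1 - (1 : Matrix (Fin (m + 1)) (Fin (m + 1)) ℂ) i 0 := by
    rw [bmatrix, Matrix.sub_apply, transpose_signedPascal_mul_apply]
    simp
  have hP₀ (k : Fin (m + 1)) : (signedPascal (m + 1) 0)ᵀ 0 k = (1 : Matrix (Fin (m + 1)) (Fin (m + 1)) ℂ) 0 k := by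
    rcases eq_or_ne k 0 with rfl | hk
    · simp [signedPascal]
    · simp [signedPascal, hk, hk.symm]
  have hP₁ (k : Fin (m + 1)) : (signedPascal (m + 1) 0)ᵀ k 0 = 1 := by
    simp [signedPascal, Ring.choose_natCast]
  rw [hPQ, Matrix.mul_add, Matrix.mul_one, adjugate_mul] at h
  have h₀ := congrFun (congrFun h 0) 0
  have h₁ := congrFun (congrFun (adjugate_mul (bmatrix μ (m + 1))) 0) 0
  rw [Matrix.mul_assoc, mul_apply] at h₀
  simp only [hP₀, one_apply, ite_mul, one_mul, zero_mul, Finset.sum_ite_eq, Finset.mem_univ, if_true,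
    mul_apply, hP₁, mul_one, Matrix.neg_apply, Matrix.add_apply, Matrix.smul_apply, smul_eq_mul] at h₀
  rw [mul_apply] at h₁
  simp only [hcol, mul_sub, Finset.sum_sub_distrib, mul_one, one_apply, mul_ite, mul_zero,
    Finset.sum_ite_eq', Finset.mem_univ, if_true, Matrix.smul_apply, smul_eq_mul] at h₁
  rw [hA, bdet_zero_zero]
  linear_combination (h₀ - h₁) / 2

/-- The odd-quotient identity (cleared form):
`b_{2n+1}(1,1)/b_{2n-1}(1,1) = -(b_{2n+1}(0,1)/b_{2n}(0,1))·(b_{2n+1}(1,0)/b_{2n}(1,0))`. -/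
theorem odd_quotient_identity (μ : ℂ) (n : ℕ) (hn : 1 ≤ n) :
    bdet μ (2 * n + 1) 1 1 * bdet μ (2 * n) 0 1 * bdet μ (2 * n) 1 0
      = -(bdet μ (2 * n - 1) 1 1 * bdet μ (2 * n + 1) 0 1 * bdet μ (2 * n + 1) 1 0) := by
  obtain ⟨k, rfl⟩ := Nat.exists_eq_add_of_le' hn
  have e : 2 * (k + 1) = 2 * k + 1 + 1 := by ring
  rw [e, Nat.add_sub_cancel]
  have c₁ := bdet_condensation μ (2 * k + 1)
  have c₂ := bdet_condensation μ (2 * k + 1 + 1)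
  rw [bdet_zero_zero_of_odd μ (N := 2 * k + 1 + 2) ⟨k + 1, by ring⟩] at c₁
  rw [bdet_zero_zero_of_odd μ (N := 2 * k + 1 + 1 + 1) ⟨k + 1, by ring⟩] at c₂
  rw [bdet_one_one_of_odd μ (m := 2 * k + 1) ⟨k, rfl⟩,
    bdet_one_one_of_odd μ (m := 2 * k + 1 + 1 + 1) ⟨k + 1, by ring⟩]
  linear_combination -bdet μ (2 * k + 1 + 1 + 2) 0 0 * c₁ - bdet μ (2 * k + 1 + 1) 0 0 * c₂
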